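/- An element w of a finite Weyl group is an involution if and only if w can be written as a product of reflections associated to pairwise orthogonal roots; in that case, the number of reflections in such a product equals the reflection length l_Δ(w). -/

import Mathlib

set_option linter.unusedSectionVars false

open scoped RealInnerProductSpace
open Module

variable {V : Type*} [NormedAddCommGroup V] [InnerProductSpace ℝ V] [FiniteDimensional ℝ V]

/-- The reflection in the hyperplane orthogonal to `γ` (the identity if `γ = 0`). -/
noncomputable def srefl (γ : V) : V →ₗ[ℝ] V :=
  LinearMap.id - (LinearMap.toSpanSingleton ℝ V ((2 / ⟪γ, γ⟫) • γ)).comp (innerSL ℝ γ).toLinearMap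

lemma srefl_apply (γ x : V) : srefl γ x = x - (2 * ⟪γ, x⟫ / ⟪γ, γ⟫) • γ := by
  simp [srefl, LinearMap.toSpanSingleton, smul_smul]
  ring_nf

lemma srefl_involutive (γ : V) : Function.Involutive (srefl γ) := by
  intro x
  rcases eq_or_ne γ 0 with h | h
  · simp [srefl_apply, h]
  · have hγ : ⟪γ, γ⟫ ≠ 0 := fun hc => h (inner_self_eq_zero.mp hc)
    rw [srefl_apply, srefl_apply, inner_sub_right, real_inner_smul_right]
    field_simp
    ring_nf
    module

/-- The reflection in `γ` as a linear automorphism of `V`. -/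
noncomputable def sref (γ : V) : V ≃ₗ[ℝ] V :=
  { srefl γ with
    invFun := srefl γ
    left_inv := srefl_involutive γ
    right_inv := srefl_involutive γ }

/-- A finite reduced crystallographic root system spanning `V`. -/
structure IsRootSystem (Δ : Set V) : Prop where
  finite : Δ.Finite
  nonzero : (0 : V) ∉ Δ
  span_top : Submodule.span ℝ Δ = ⊤
  refl_mem : ∀ γ ∈ Δ, ∀ β ∈ Δ, sref γ β ∈ Δ
  crystallographic : ∀ γ ∈ Δ, ∀ β ∈ Δ, ∃ m : ℤ, 2 * ⟪β, γ⟫ / ⟪γ, γ⟫ = (m : ℝ)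
  reduced : ∀ γ ∈ Δ, ∀ t : ℝ, t • γ ∈ Δ → t = 1 ∨ t = -1

/-- The Weyl group: the subgroup of `GL(V)` generated by the reflections in the roots. -/
def weylGroup (Δ : Set V) : Subgroup (V ≃ₗ[ℝ] V) :=
  Subgroup.closure {g | ∃ γ ∈ Δ, g = sref γ}

/-- The reflection length of `w`: the least number of reflections in roots whose
product is `w`. -/
noncomputable def reflLength (Δ : Set V) (w : V ≃ₗ[ℝ] V) : ℕ :=
  sInf {r | ∃ γ : Fin r → V, (∀ i, γ i ∈ Δ) ∧ w = (List.ofFn fun i => sref (γ i)).prod}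

/-- A base (system of simple roots `α` with positive roots `Pos`) for the root system `Δ`. -/
structure IsBase (Δ Pos : Set V) {n : ℕ} (α : Fin n → V) : Prop where
  pos_subset : Pos ⊆ Δ
  simple_mem : ∀ i, α i ∈ Pos
  mem_or_neg : ∀ γ ∈ Δ, γ ∈ Pos ∨ -γ ∈ Pos
  not_neg : ∀ γ ∈ Pos, -γ ∉ Pos
  pos_combo : ∀ γ ∈ Pos, ∃ c : Fin n → ℕ, γ = ∑ j, (c j : ℝ) • α j

/-- `l` is a word (in the simple reflections) for `w`. -/
def IsWord {n : ℕ} (α : Fin n → V) (l : List (Fin n)) (w : V ≃ₗ[ℝ] V) : Prop :=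
  (l.map fun j => sref (α j)).prod = w

/-- The Coxeter length of `w` with respect to the simple system `α`. -/
noncomputable def len {n : ℕ} (α : Fin n → V) (w : V ≃ₗ[ℝ] V) : ℕ :=
  sInf {r | ∃ l : List (Fin n), IsWord α l w ∧ l.length = r}

/-- Bruhat order: `v ≤ w` iff some reduced word for `w` has a subword with value `v`. -/
def bruhatLE {n : ℕ} (α : Fin n → V) (v w : V ≃ₗ[ℝ] V) : Prop :=
  ∃ l : List (Fin n), IsWord α l w ∧ l.length = len α w ∧
    ∃ l' : List (Fin n), l'.Sublist l ∧ IsWord α l' v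

/-- The product of the simple reflections indexed by a word given as a function
`i : Fin m → Fin n`, along a list of positions. -/
noncomputable def fwordProd {n m : ℕ} (α : Fin n → V) (i : Fin m → Fin n)
    (l : List (Fin m)) : V ≃ₗ[ℝ] V :=
  (l.map fun j => sref (α (i j))).prod

/-- The full product `s_{i₁} ⋯ s_{i_m}`. -/
noncomputable def fullProd {n m : ℕ} (α : Fin n → V) (i : Fin m → Fin n) : V ≃ₗ[ℝ] V :=
  fwordProd α i (List.finRange m)

/-- The root `β_k = s_{i₁} ⋯ s_{i_{k-1}} (α_{i_k})` associated to the `k`-th position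
of the word `i` (positions indexed from `0`). -/
noncomputable def betaRoot {n m : ℕ} (α : Fin n → V) (i : Fin m → Fin n) (k : Fin m) : V :=
  fwordProd α i ((List.finRange m).take k) (α (i k))

/-- The value of the subword of `i` obtained by deleting the positions `p t`. -/
noncomputable def complProd {n m d : ℕ} (α : Fin n → V) (i : Fin m → Fin n)
    (p : Fin d → Fin m) : V ≃ₗ[ℝ] V :=
  fwordProd α i ((List.finRange m).filter fun j => ∀ t, p t ≠ j)

lemma sref_apply (γ x : V) : sref γ x = x - (2 * ⟪γ, x⟫ / ⟪γ, γ⟫) • γ := srefl_apply γ x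

lemma sref_sref (γ x : V) : sref γ (sref γ x) = x := srefl_involutive γ x

lemma sref_mul_self (γ : V) : sref γ * sref γ = 1 := LinearEquiv.ext (sref_sref γ)

lemma sref_self (γ : V) : sref γ γ = -γ := by
  rcases eq_or_ne γ 0 with rfl | h
  · simp
  · have hγ : ⟪γ, γ⟫ ≠ 0 := fun hc => h (inner_self_eq_zero.mp hc)
    rw [sref_apply, mul_div_assoc, div_self hγ]
    module

lemma sref_of_orthogonal {γ x : V} (h : ⟪γ, x⟫ = 0) : sref γ x = x := by
  simp [sref_apply, h]

lemma sref_neg (γ : V) : sref (-γ) = sref γ := by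
  ext x
  simp [sref_apply, neg_div]

lemma inner_sref_sref (γ x y : V) : ⟪sref γ x, sref γ y⟫ = ⟪x, y⟫ := by
  rcases eq_or_ne γ 0 with rfl | h
  · simp [sref_apply]
  · have hγ : ⟪γ, γ⟫ ≠ 0 := fun hc => h (inner_self_eq_zero.mp hc)
    simp only [sref_apply, inner_sub_left, inner_sub_right, real_inner_smul_left,
      real_inner_smul_right, real_inner_comm γ x]
    field_simp
    ring

lemma sref_conj {g : V ≃ₗ[ℝ] V} (hg : ∀ x y, ⟪g x, g y⟫ = ⟪x, y⟫) (γ : V) :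
    sref (g γ) * g = g * sref γ := by
  ext x
  simp only [LinearEquiv.mul_apply, sref_apply, map_sub, map_smul, hg]

lemma commute_sref {γ δ : V} (h : ⟪γ, δ⟫ = 0) : Commute (sref γ) (sref δ) := by
  have := sref_conj (inner_sref_sref γ) δ
  rw [sref_of_orthogonal h] at this
  exact this.symm

lemma inner_weylGroup {Δ : Set V} {w : V ≃ₗ[ℝ] V} (hw : w ∈ weylGroup Δ) :
    ∀ x y, ⟪w x, w y⟫ = ⟪x, y⟫ := by
  induction hw using Subgroup.closure_induction with
  | mem g hg =>
    obtain ⟨γ, -, rfl⟩ := hg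
    exact inner_sref_sref γ
  | one => simp
  | mul g h _ _ hg hh => simp [hg, hh]
  | inv g _ hg =>
    intro x y
    have := hg (g⁻¹ x) (g⁻¹ y)
    simpa [← LinearEquiv.mul_apply] using this.symm

lemma sref_mem_weylGroup {Δ : Set V} {γ : V} (h : γ ∈ Δ) : sref γ ∈ weylGroup Δ :=
  Subgroup.subset_closure ⟨γ, h, rfl⟩

lemma list_prod_mem_weylGroup {Δ : Set V} {L : List V} (h : ∀ γ ∈ L, γ ∈ Δ) :
    (L.map sref).prod ∈ weylGroup Δ :=
  Subgroup.list_prod_mem _ fun g hg => by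
    obtain ⟨γ, hγ, rfl⟩ := List.mem_map.mp hg
    exact sref_mem_weylGroup (h γ hγ)

lemma IsRootSystem.neg_mem {Δ : Set V} (hΔ : IsRootSystem Δ) {γ : V} (h : γ ∈ Δ) : -γ ∈ Δ := by
  simpa [sref_self] using hΔ.refl_mem γ h γ h

/-! ### The action on regular vectors is free -/

/-- The roots on the positive side of `x`. -/
def posRoots (Δ : Set V) (x : V) : Set V := {β ∈ Δ | 0 < ⟪x, β⟫}

/-- The positive roots whose reflection permutes all the other positive roots. -/
def simpleRoots (Δ : Set V) (x : V) : Set V :=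
  {α ∈ posRoots Δ x | ∀ γ ∈ posRoots Δ x, γ ≠ α → sref α γ ∈ posRoots Δ x}

section Regular

variable {Δ : Set V} {x : V}

lemma inner_nonneg_of_mem_span {S : Set V} (hS : S ⊆ posRoots Δ x) {v : V}
    (hv : v ∈ Submodule.span NNReal S) : 0 ≤ ⟪x, v⟫ ∧ (⟪x, v⟫ = 0 → v = 0) := by
  induction hv using Submodule.span_induction with
  | mem v hv => exact ⟨(hS hv).2.le, fun h => absurd h (hS hv).2.ne'⟩
  | zero => simp
  | add u v _ _ hu hv =>
    rw [inner_add_right]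
    refine ⟨add_nonneg hu.1 hv.1, fun h => ?_⟩
    rw [hu.2 (by linarith [hu.1, hv.1]), hv.2 (by linarith [hu.1, hv.1]), add_zero]
  | smul c v _ hv =>
    rw [NNReal.smul_def, real_inner_smul_right]
    refine ⟨mul_nonneg c.2 hv.1, fun h => ?_⟩
    rcases mul_eq_zero.mp h with h | h
    · simp [h]
    · simp [hv.2 h]

lemma IsRootSystem.mem_posRoots_or_neg_mem (hΔ : IsRootSystem Δ) (hx : ∀ β ∈ Δ, ⟪x, β⟫ ≠ 0)
    {β : V} (hβ : β ∈ Δ) : β ∈ posRoots Δ x ∨ -β ∈ posRoots Δ x := by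
  rcases (hx β hβ).lt_or_gt with h | h
  · exact Or.inr ⟨hΔ.neg_mem hβ, by simpa using h⟩
  · exact Or.inl ⟨hβ, h⟩

lemma IsRootSystem.eq_of_smul_mem_posRoots (hΔ : IsRootSystem Δ) {α : V} {t : ℝ}
    (hα : α ∈ posRoots Δ x) (ht : t • α ∈ posRoots Δ x) : t • α = α := by
  rcases hΔ.reduced α hα.1 t ht.1 with rfl | rfl
  · simp
  · have h1 := ht.2
    have h2 := hα.2
    simp at h1
    linarith

lemma IsRootSystem.mem_simpleRoots_of_notMem_span (hΔ : IsRootSystem Δ)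
    (hx : ∀ β ∈ Δ, ⟪x, β⟫ ≠ 0) {S : Set V} (hS : S ⊆ posRoots Δ x)
    (hspan : posRoots Δ x ⊆ Submodule.span NNReal S) {α : V} (hα : α ∈ S)
    (hmin : α ∉ Submodule.span NNReal (S \ {α})) : α ∈ simpleRoots Δ x := by
  refine ⟨hS hα, fun γ hγ hne => ?_⟩
  refine (hΔ.mem_posRoots_or_neg_mem hx (hΔ.refl_mem α (hS hα).1 γ hγ.1)).resolve_right
    fun hδ => ?_
  have hins : insert α (S \ {α}) = S := Set.insert_sdiff_self_of_mem hα
  have hsub : S \ {α} ⊆ posRoots Δ x := Set.sdiff_subset.trans hS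
  obtain ⟨a, g, hg, hγe⟩ := Submodule.mem_span_insert.mp (hins ▸ hspan hγ)
  obtain ⟨b, d, hd, hδe⟩ := Submodule.mem_span_insert.mp (hins ▸ hspan hδ)
  obtain ⟨hg0, hg1⟩ := inner_nonneg_of_mem_span hsub hg
  obtain ⟨hd0, -⟩ := inner_nonneg_of_mem_span hsub hd
  rw [sref_apply] at hδe
  set c : ℝ := 2 * ⟪α, γ⟫ / ⟪α, α⟫
  rw [NNReal.smul_def] at hγe hδe
  have key : (c - a - b) • α = g + d := by
    have : c • α = γ + -(γ - c • α) := by abel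
    rw [sub_smul, sub_smul, this, hδe]
    nth_rewrite 1 [hγe]
    abel
  have hα0 := (hS hα).2
  rcases lt_or_ge 0 (c - a - b) with hc | hc
  · refine hmin ?_
    have hmem := Submodule.smul_mem _ (Real.toNNReal (c - a - b)⁻¹) (Submodule.add_mem _ hg hd)
    rwa [← key, NNReal.smul_def, Real.coe_toNNReal _ (inv_nonneg.mpr hc.le), smul_smul,
      inv_mul_cancel₀ hc.ne', one_smul] at hmem
  · have := congrArg (fun v => ⟪x, v⟫) key
    simp only [real_inner_smul_right, inner_add_right] at this
    have hneg := mul_nonpos_of_nonpos_of_nonneg hc hα0.le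
    rw [hg1 (by linarith), add_zero] at hγe
    subst hγe
    exact hne (hΔ.eq_of_smul_mem_posRoots (hS hα) hγ)

lemma IsRootSystem.posRoots_subset_span (hΔ : IsRootSystem Δ) (hx : ∀ β ∈ Δ, ⟪x, β⟫ ≠ 0) :
    posRoots Δ x ⊆ Submodule.span NNReal (simpleRoots Δ x) := by
  have hfin : (posRoots Δ x).Finite := hΔ.finite.subset fun _ h => h.1
  have hne : {S | S ⊆ posRoots Δ x ∧ posRoots Δ x ⊆ Submodule.span NNReal S}.Nonempty :=
    ⟨_, subset_rfl, Submodule.subset_span⟩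
  have hfin' : {S | S ⊆ posRoots Δ x ∧ posRoots Δ x ⊆ Submodule.span NNReal S}.Finite :=
    hfin.finite_subsets.subset fun _ h => h.1
  obtain ⟨S, ⟨hS, hspan⟩, hmin⟩ := hfin'.exists_minimal hne
  refine hspan.trans (Submodule.span_mono fun α hα => ?_)
  refine hΔ.mem_simpleRoots_of_notMem_span hx hS hspan hα fun hmem => ?_
  have hle : Submodule.span NNReal S ≤ Submodule.span NNReal (S \ {α}) :=
    Submodule.span_le.mpr fun β hβ => by
      by_cases h : β = α
      · exact h ▸ hmem
      · exact Submodule.subset_span ⟨hβ, h⟩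
  exact (hmin ⟨Set.sdiff_subset.trans hS, hspan.trans hle⟩ Set.sdiff_subset hα).2 rfl

lemma IsRootSystem.exists_simple_inner_pos (hΔ : IsRootSystem Δ) (hx : ∀ β ∈ Δ, ⟪x, β⟫ ≠ 0)
    {β : V} (hβ : β ∈ posRoots Δ x) : ∃ α ∈ simpleRoots Δ x, 0 < ⟪α, β⟫ := by
  by_contra! h
  have key : ∀ v ∈ Submodule.span NNReal (simpleRoots Δ x), ⟪v, β⟫ ≤ 0 := fun v hv => by
    induction hv using Submodule.span_induction with
    | mem v hv => exact h v hv
    | zero => simp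
    | add u v _ _ hu hv => rw [inner_add_left]; linarith
    | smul c v _ hv =>
      rw [NNReal.smul_def, real_inner_smul_left]
      exact mul_nonpos_of_nonneg_of_nonpos c.2 hv
  have hβ0 : β ≠ 0 := fun h => hΔ.nonzero (h ▸ hβ.1)
  exact (real_inner_self_pos.mpr hβ0).not_ge (key β (hΔ.posRoots_subset_span hx hβ))

lemma IsRootSystem.sref_mem_weylGroup_simpleRoots (hΔ : IsRootSystem Δ)
    (hx : ∀ β ∈ Δ, ⟪x, β⟫ ≠ 0) {β : V} (hβ : β ∈ posRoots Δ x) :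
    sref β ∈ weylGroup (simpleRoots Δ x) := by
  by_contra hbad
  have hfin : {β ∈ posRoots Δ x | sref β ∉ weylGroup (simpleRoots Δ x)}.Finite :=
    hΔ.finite.subset fun _ h => h.1.1
  obtain ⟨γ, ⟨hγ, hγbad⟩, hmin⟩ :=
    Set.exists_min_image _ (fun v => ⟪x, v⟫) hfin ⟨β, hβ, hbad⟩
  obtain ⟨α, hα, hpos⟩ := hΔ.exists_simple_inner_pos hx hγ
  have hne : γ ≠ α := fun h => hγbad (h ▸ sref_mem_weylGroup hα)
  have hmem := hα.2 γ hγ hne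
  have hα0 : α ≠ 0 := fun h => hΔ.nonzero (h ▸ hα.1.1)
  have hlt : ⟪x, sref α γ⟫ < ⟪x, γ⟫ := by
    rw [sref_apply, inner_sub_right, real_inner_smul_right]
    have := hα.1.2
    have := real_inner_self_pos.mpr hα0
    have : 0 < 2 * ⟪α, γ⟫ / ⟪α, α⟫ * ⟪x, α⟫ := by positivity
    linarith
  have hgood : sref (sref α γ) ∈ weylGroup (simpleRoots Δ x) := by
    by_contra h
    exact (hmin _ ⟨hmem, h⟩).not_gt hlt
  have hconj := sref_conj (inner_sref_sref α) γ
  have : sref γ = sref α * (sref (sref α γ) * sref α) := by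
    rw [hconj, ← mul_assoc, sref_mul_self, one_mul]
  refine hγbad (this ▸ mul_mem ?_ (mul_mem hgood ?_)) <;> exact sref_mem_weylGroup hα

lemma exists_list_of_mem_weylGroup {w : V ≃ₗ[ℝ] V} (hw : w ∈ weylGroup Δ) :
    ∃ L : List V, (∀ γ ∈ L, γ ∈ Δ) ∧ (L.map sref).prod = w := by
  induction hw using Subgroup.closure_induction with
  | mem g hg =>
    obtain ⟨γ, hγ, rfl⟩ := hg
    exact ⟨[γ], by simpa, by simp⟩
  | one => exact ⟨[], by simp, by simp⟩
  | mul g h _ _ hg hh =>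
    obtain ⟨L, hL, rfl⟩ := hg
    obtain ⟨M, hM, rfl⟩ := hh
    refine ⟨L ++ M, fun γ hγ => ?_, by simp⟩
    exact (List.mem_append.mp hγ).elim (hL γ) (hM γ)
  | inv g _ hg =>
    obtain ⟨L, hL, rfl⟩ := hg
    refine ⟨L.reverse, fun γ hγ => hL γ (List.mem_reverse.mp hγ), ?_⟩
    rw [List.prod_inv_reverse, List.map_reverse, List.map_map]
    congr 3

lemma exists_shorter_word {α : V}
    (hα : α ∈ simpleRoots Δ x) (L : List V) (hL : ∀ γ ∈ L, γ ∈ simpleRoots Δ x)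
    (hneg : (L.map sref).prod α ∉ posRoots Δ x) :
    ∃ L' : List V, (∀ γ ∈ L', γ ∈ simpleRoots Δ x) ∧ L'.length < L.length ∧
      (L'.map sref).prod = (L.map sref).prod * sref α := by
  induction L with
  | nil => exact absurd (by simpa using hα.1) hneg
  | cons a t ih =>
    have ha : a ∈ simpleRoots Δ x := hL a (by simp)
    have ht : ∀ γ ∈ t, γ ∈ simpleRoots Δ x := fun γ hγ => hL γ (by simp [hγ])
    by_cases h : (t.map sref).prod α ∈ posRoots Δ x
    · refine ⟨t, ht, by simp, ?_⟩
      have hta : (t.map sref).prod α = a := by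
        by_contra hne
        exact hneg (by simpa using ha.2 _ h hne)
      have hconj := sref_conj (inner_weylGroup (list_prod_mem_weylGroup ht)) α
      rw [hta] at hconj
      rw [List.map_cons, List.prod_cons, mul_assoc, ← hconj, ← mul_assoc, sref_mul_self, one_mul]
    · obtain ⟨L', hL', hlen, hprod⟩ := ih ht h
      refine ⟨a :: L', ?_, by simpa, by simp [hprod, mul_assoc]⟩
      simpa [ha] using hL'

lemma list_prod_eq_one_of_apply_eq (n : ℕ) (L : List V)
    (hn : L.length ≤ n) (hL : ∀ γ ∈ L, γ ∈ simpleRoots Δ x) (hfix : (L.map sref).prod x = x) :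
    (L.map sref).prod = 1 := by
  induction n generalizing L with
  | zero => simp [List.length_eq_zero_iff.mp (Nat.le_zero.mp hn)]
  | succ n ih =>
    rcases L.eq_nil_or_concat with rfl | ⟨M, α, rfl⟩
    · simp
    have hα : α ∈ simpleRoots Δ x := hL α (by simp)
    have hM : ∀ γ ∈ M, γ ∈ simpleRoots Δ x := fun γ hγ => hL γ (by simp [hγ])
    have hneg : (M.map sref).prod α ∉ posRoots Δ x := fun h => by
      have h1 := inner_weylGroup (list_prod_mem_weylGroup hL) x α
      rw [hfix] at h1
      simp [sref_self] at h1
      linarith [h.2, hα.1.2]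
    obtain ⟨L', hL', hlen, hprod⟩ := exists_shorter_word hα M hM hneg
    have hEq : (L'.map sref).prod = ((M.concat α).map sref).prod := by simp [hprod]
    have hlen' : L'.length ≤ n := by
      simp at hn
      omega
    rw [← hEq] at hfix ⊢
    exact ih L' hlen' hL' hfix

lemma IsRootSystem.eq_one_of_apply_eq_of_regular (hΔ : IsRootSystem Δ)
    (hx : ∀ β ∈ Δ, ⟪x, β⟫ ≠ 0) {w : V ≃ₗ[ℝ] V} (hw : w ∈ weylGroup Δ) (hfix : w x = x) :
    w = 1 := by
  have hle : weylGroup Δ ≤ weylGroup (simpleRoots Δ x) := by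
    refine (Subgroup.closure_le _).mpr ?_
    rintro _ ⟨γ, hγ, rfl⟩
    rcases hΔ.mem_posRoots_or_neg_mem hx hγ with h | h
    · exact hΔ.sref_mem_weylGroup_simpleRoots hx h
    · exact sref_neg γ ▸ hΔ.sref_mem_weylGroup_simpleRoots hx h
  obtain ⟨L, hL, rfl⟩ := exists_list_of_mem_weylGroup (hle hw)
  exact list_prod_eq_one_of_apply_eq _ L le_rfl hL hfix

end Regular

/-! ### Involutions and orthogonal roots -/

lemma IsRootSystem.exists_root_orthogonal_fixed {Δ : Set V} (hΔ : IsRootSystem Δ)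
    {w : V ≃ₗ[ℝ] V} (hw : w ∈ weylGroup Δ) (hne : w ≠ 1) :
    ∃ β ∈ Δ, ∀ v, w v = v → ⟪v, β⟫ = 0 := by
  by_contra! h
  let F : Submodule ℝ V := LinearMap.eqLocus (w : V →ₗ[ℝ] V) LinearMap.id
  have := hΔ.finite.to_subtype
  obtain ⟨x, hxF, hx⟩ := Module.Dual.exists_forall_mem_ne_zero_of_forall_exists F
    (fun β : Δ => (innerSL ℝ (β : V)).toLinearMap) fun β => by
      obtain ⟨v, hv, hvβ⟩ := h β β.2
      exact ⟨v, hv, by simpa [real_inner_comm] using hvβ⟩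
  refine hne (hΔ.eq_one_of_apply_eq_of_regular (x := x) (fun β hβ => ?_) hw hxF)
  simpa [real_inner_comm] using hx ⟨β, hβ⟩

lemma IsRootSystem.exists_root_apply_eq_neg {Δ : Set V} (hΔ : IsRootSystem Δ)
    {w : V ≃ₗ[ℝ] V} (hw : w ∈ weylGroup Δ) (hinv : w * w = 1) (hne : w ≠ 1) :
    ∃ β ∈ Δ, w β = -β ∧ ∀ v, w v = v → ⟪v, β⟫ = 0 := by
  obtain ⟨β, hβ, horth⟩ := hΔ.exists_root_orthogonal_fixed hw hne
  refine ⟨β, hβ, eq_neg_of_add_eq_zero_left ?_, horth⟩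
  have hww : w (w β) = β := LinearEquiv.congr_fun hinv β
  have hfix : w (w β + β) = w β + β := by rw [map_add, hww, add_comm]
  have h1 := horth _ hfix
  have h2 := inner_weylGroup hw (w β + β) β
  rw [hfix, h1] at h2
  rw [← inner_self_eq_zero (𝕜 := ℝ), inner_add_right, h1, h2, add_zero]

lemma list_prod_apply_of_orthogonal {L : List V} {v : V} (h : ∀ γ ∈ L, ⟪γ, v⟫ = 0) :
    (L.map sref).prod v = v := by
  induction L with
  | nil => simp
  | cons a t ih =>
    simp only [List.map_cons, List.prod_cons, LinearEquiv.mul_apply]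
    rw [ih fun γ hγ => h γ (by simp [hγ]), sref_of_orthogonal (h a (by simp))]

lemma list_prod_apply_of_mem {L : List V} (hL : L.Pairwise fun γ δ => ⟪γ, δ⟫ = 0) {γ : V}
    (hγ : γ ∈ L) : (L.map sref).prod γ = -γ := by
  induction L with
  | nil => simp at hγ
  | cons a t ih =>
    obtain ⟨ha, ht⟩ := List.pairwise_cons.mp hL
    simp only [List.map_cons, List.prod_cons, LinearEquiv.mul_apply]
    rcases List.mem_cons.mp hγ with rfl | hγ
    · rw [list_prod_apply_of_orthogonal fun δ hδ => real_inner_comm γ δ ▸ ha δ hδ, sref_self]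
    · rw [ih ht hγ, map_neg, sref_of_orthogonal (ha γ hγ)]

lemma list_prod_mul_self {L : List V} (hL : L.Pairwise fun γ δ => ⟪γ, δ⟫ = 0) :
    (L.map sref).prod * (L.map sref).prod = 1 := by
  induction L with
  | nil => simp
  | cons a t ih =>
    obtain ⟨ha, ht⟩ := List.pairwise_cons.mp hL
    have hc : Commute (sref a) (t.map sref).prod := Commute.list_prod_right _ _ fun g hg => by
      obtain ⟨δ, hδ, rfl⟩ := List.mem_map.mp hg
      exact commute_sref (ha δ hδ)
    rw [List.map_cons, List.prod_cons, hc.symm.mul_mul_mul_comm, sref_mul_self, ih ht, one_mul]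

lemma length_le_finrank_of_pairwise_orthogonal {L : List V}
    (hL : L.Pairwise fun γ δ => ⟪γ, δ⟫ = 0) (h0 : (0 : V) ∉ L) {M : Submodule ℝ V}
    (hM : ∀ γ ∈ L, γ ∈ M) : L.length ≤ finrank ℝ M := by
  have hli : LinearIndependent ℝ L.get := by
    refine linearIndependent_of_ne_zero_of_inner_eq_zero
      (fun i h => h0 (h ▸ List.get_mem L i)) fun i j hij => ?_
    rcases hij.lt_or_gt with h | h
    · exact List.pairwise_iff_get.mp hL i j h
    · rw [real_inner_comm]
      exact List.pairwise_iff_get.mp hL j i h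
  have hli' : LinearIndependent ℝ fun i => (⟨L.get i, hM _ (List.get_mem L i)⟩ : M) :=
    LinearIndependent.of_comp M.subtype hli
  simpa using hli'.fintype_card_le_finrank

lemma list_prod_sub_mem_span (L : List V) (v : V) :
    (L.map sref).prod v - v ∈ Submodule.span ℝ {γ | γ ∈ L} := by
  induction L with
  | nil => simp
  | cons a t ih =>
    simp only [List.map_cons, List.prod_cons, LinearEquiv.mul_apply]
    rw [sref_apply, sub_right_comm]
    refine Submodule.sub_mem _ (Submodule.span_mono (fun γ hγ => ?_) ih)
      (Submodule.smul_mem _ _ (Submodule.subset_span (by simp)))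
    exact List.mem_cons_of_mem a hγ

/-- Pairwise orthogonal roots give a shortest expression of their product. -/
lemma length_le_of_list_prod_eq {L M : List V} (hL : L.Pairwise fun γ δ => ⟪γ, δ⟫ = 0)
    (h0 : (0 : V) ∉ L) (h : (L.map sref).prod = (M.map sref).prod) : L.length ≤ M.length := by
  classical
  have hmem : ∀ γ ∈ L, γ ∈ Submodule.span ℝ {γ | γ ∈ M} := fun γ hγ => by
    have := list_prod_sub_mem_span M γ
    rw [← h, list_prod_apply_of_mem hL hγ] at this
    convert Submodule.smul_mem _ (-2⁻¹ : ℝ) this using 1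
    module
  refine (length_le_finrank_of_pairwise_orthogonal hL h0 hmem).trans ?_
  have hcoe : {γ | γ ∈ M} = (M.toFinset : Set V) := by ext; simp
  rw [hcoe]
  exact (finrank_span_finset_le_card _).trans M.toFinset_card_le

lemma IsRootSystem.exists_extend_orthogonal {Δ : Set V} (hΔ : IsRootSystem Δ)
    {w : V ≃ₗ[ℝ] V} (hw : w ∈ weylGroup Δ) (hinv : w * w = 1) (k : ℕ) (L : List V)
    (hk : finrank ℝ V ≤ L.length + k) (hLΔ : ∀ γ ∈ L, γ ∈ Δ)
    (hL : L.Pairwise fun γ δ => ⟪γ, δ⟫ = 0) (hneg : ∀ γ ∈ L, w γ = -γ) :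
    ∃ L' : List V, (∀ γ ∈ L', γ ∈ Δ) ∧ (L'.Pairwise fun γ δ => ⟪γ, δ⟫ = 0) ∧
      w = (L'.map sref).prod := by
  by_cases hwL : w = (L.map sref).prod
  · exact ⟨L, hLΔ, hL, hwL⟩
  have hsq := list_prod_mul_self hL
  have hcomm : Commute w (L.map sref).prod := Commute.list_prod_right _ _ fun g hg => by
    obtain ⟨γ, hγ, rfl⟩ := List.mem_map.mp hg
    have := sref_conj (inner_weylGroup hw) γ
    rw [hneg γ hγ, sref_neg] at this
    exact this.symm
  obtain ⟨β, hβ, hβneg, horth⟩ := hΔ.exists_root_apply_eq_neg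
    (w := w * (L.map sref).prod) (mul_mem hw (list_prod_mem_weylGroup hLΔ))
    (by rw [hcomm.symm.mul_mul_mul_comm, hinv, hsq, one_mul])
    (fun h => hwL (by rw [← mul_one w, ← hsq, ← mul_assoc, h, one_mul]))
  have hβL : ∀ γ ∈ L, ⟪γ, β⟫ = 0 := fun γ hγ => horth γ (by
    rw [LinearEquiv.mul_apply, list_prod_apply_of_mem hL hγ, map_neg, hneg γ hγ, neg_neg])
  rw [LinearEquiv.mul_apply, list_prod_apply_of_orthogonal hβL] at hβneg
  have hLΔ' : ∀ γ ∈ β :: L, γ ∈ Δ := by simpa [hβ] using hLΔ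
  have hL' : (β :: L).Pairwise fun γ δ => ⟪γ, δ⟫ = 0 :=
    List.pairwise_cons.mpr ⟨fun γ hγ => by rw [real_inner_comm]; exact hβL γ hγ, hL⟩
  cases k with
  | zero =>
    have := length_le_finrank_of_pairwise_orthogonal hL' (fun h => hΔ.nonzero (hLΔ' 0 h))
      (M := ⊤) (by simp)
    rw [finrank_top, List.length_cons] at this
    omega
  | succ k =>
    exact hΔ.exists_extend_orthogonal hw hinv k (β :: L) (by simp; omega) hLΔ' hL'
      (by simpa [hβneg] using hneg)

theorem statement3 {Δ : Set V} (hΔ : IsRootSystem Δ) (w : V ≃ₗ[ℝ] V)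
    (hw : w ∈ weylGroup Δ) :
    (w * w = 1 ↔
        ∃ (r : ℕ) (γ : Fin r → V), (∀ i, γ i ∈ Δ) ∧ (∀ i j, i ≠ j → ⟪γ i, γ j⟫ = 0) ∧
          w = (List.ofFn fun i => sref (γ i)).prod) ∧
      ∀ (r : ℕ) (γ : Fin r → V), (∀ i, γ i ∈ Δ) → (∀ i j, i ≠ j → ⟪γ i, γ j⟫ = 0) →
        w = (List.ofFn fun i => sref (γ i)).prod → r = reflLength Δ w := by
  have hpw : ∀ {r : ℕ} {γ : Fin r → V}, (∀ i j, i ≠ j → ⟪γ i, γ j⟫ = 0) →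
      (List.ofFn γ).Pairwise fun γ δ => ⟪γ, δ⟫ = 0 := fun h =>
    List.pairwise_ofFn.mpr fun i j hij => h i j hij.ne
  have hmap : ∀ {r : ℕ} (γ : Fin r → V),
      (List.ofFn fun i => sref (γ i)) = (List.ofFn γ).map sref := fun γ => by
    rw [List.map_ofFn]
    rfl
  refine ⟨⟨fun hinv => ?_, ?_⟩, fun r γ hγ horth hprod => le_antisymm ?_ ?_⟩
  · obtain ⟨L, hLΔ, hL, rfl⟩ := hΔ.exists_extend_orthogonal hw hinv (finrank ℝ V) [] (by simp)
      (by simp) (by simp) (by simp)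
    refine ⟨L.length, L.get, fun i => hLΔ _ (List.get_mem L i), fun i j hij => ?_, ?_⟩
    · rcases hij.lt_or_gt with h | h
      · exact List.pairwise_iff_get.mp hL i j h
      · rw [real_inner_comm]
        exact List.pairwise_iff_get.mp hL j i h
    · rw [hmap, List.ofFn_get]
  · rintro ⟨r, γ, -, horth, rfl⟩
    rw [hmap]
    exact list_prod_mul_self (hpw horth)
  · refine le_csInf ⟨r, γ, hγ, hprod⟩ ?_
    rintro k ⟨δ, -, hδ⟩
    rw [hmap] at hprod hδ
    have h0 : (0 : V) ∉ List.ofFn γ := fun h => by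
      obtain ⟨i, hi⟩ := (List.mem_ofFn' γ 0).mp h
      exact hΔ.nonzero (hi ▸ hγ i)
    simpa using length_le_of_list_prod_eq (hpw horth) h0 (hprod.symm.trans hδ)
  · exact Nat.sInf_le ⟨γ, hγ, hprod⟩
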